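/- Fix nonempty finite sets Ω and A, a finite message set M with |M| > max{|Ω|, |A|}, and an interior prior μ₀ on Ω. Then there is a generic set of environments such that for every environment (u_S, u_R) in that set: if cheap-talk Sender values randomization, then commitment is valuable. -/

import Mathlib

open MeasureTheory

namespace KL

/-- `f` is a probability distribution on the finite type `X`. -/
def IsDist {X : Type} [Fintype X] (f : X → ℝ) : Prop :=
  (∀ x, 0 ≤ f x) ∧ ∑ x, f x = 1

/-- `μ₀` is an interior prior on `Ω`. -/
def IsPrior {Ω : Type} [Fintype Ω] (μ₀ : Ω → ℝ) : Prop :=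
  (∀ ω, 0 < μ₀ ω) ∧ ∑ ω, μ₀ ω = 1

variable {Ω A M : Type} [Fintype Ω] [Fintype A] [Fintype M]

/-- A messaging strategy: a distribution over messages in each state. -/
def IsMsg (σ : Ω → M → ℝ) : Prop := ∀ ω, IsDist (σ ω)

/-- An action strategy: a distribution over actions after each message. -/
def IsAct (ρ : M → A → ℝ) : Prop := ∀ m, IsDist (ρ m)

/-- Expected payoff of a profile `(σ, ρ)` for utility `u`. -/
def U (μ₀ : Ω → ℝ) (u : A × Ω → ℝ) (σ : Ω → M → ℝ) (ρ : M → A → ℝ) : ℝ :=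
  ∑ ω, ∑ m, ∑ a, μ₀ ω * σ ω m * ρ m a * u (a, ω)

/-- Sender best response. -/
def SBR (μ₀ : Ω → ℝ) (uS : A × Ω → ℝ) (σ : Ω → M → ℝ) (ρ : M → A → ℝ) : Prop :=
  ∀ σ' : Ω → M → ℝ, IsMsg σ' → U μ₀ uS σ' ρ ≤ U μ₀ uS σ ρ

/-- Receiver best response. -/
def RBR (μ₀ : Ω → ℝ) (uR : A × Ω → ℝ) (σ : Ω → M → ℝ) (ρ : M → A → ℝ) : Prop :=
  ∀ ρ' : M → A → ℝ, IsAct ρ' → U μ₀ uR σ ρ' ≤ U μ₀ uR σ ρ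

/-- A cheap-talk equilibrium: a profile of valid strategies that is S-BR and R-BR. -/
def CTEq (μ₀ : Ω → ℝ) (uS uR : A × Ω → ℝ) (σ : Ω → M → ℝ) (ρ : M → A → ℝ) : Prop :=
  IsMsg σ ∧ IsAct ρ ∧ SBR μ₀ uS σ ρ ∧ RBR μ₀ uR σ ρ

/-- A persuasion profile: a profile of valid strategies that is R-BR. -/
def PersProfile (μ₀ : Ω → ℝ) (uR : A × Ω → ℝ) (σ : Ω → M → ℝ) (ρ : M → A → ℝ) : Prop :=
  IsMsg σ ∧ IsAct ρ ∧ RBR μ₀ uR σ ρ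

/-- The cheap-talk payoff: the maximal Sender payoff over cheap-talk equilibria. -/
noncomputable def ctPayoff (μ₀ : Ω → ℝ) (uS uR : A × Ω → ℝ) : ℝ :=
  sSup {x | ∃ (σ : Ω → M → ℝ) (ρ : M → A → ℝ), CTEq μ₀ uS uR σ ρ ∧ x = U μ₀ uS σ ρ}

/-- The (Bayesian) persuasion payoff: the maximal Sender payoff over persuasion profiles. -/
noncomputable def persPayoff (μ₀ : Ω → ℝ) (uS uR : A × Ω → ℝ) : ℝ :=
  sSup {x | ∃ (σ : Ω → M → ℝ) (ρ : M → A → ℝ), PersProfile μ₀ uR σ ρ ∧ x = U μ₀ uS σ ρ}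

/-- A messaging strategy is partitional if it is deterministic in every state. -/
def Partitional (σ : Ω → M → ℝ) : Prop := ∀ ω, ∃ m, σ ω m = 1

/-- The partitional persuasion payoff. -/
noncomputable def partPersPayoff (μ₀ : Ω → ℝ) (uS uR : A × Ω → ℝ) : ℝ :=
  sSup {x | ∃ (σ : Ω → M → ℝ) (ρ : M → A → ℝ),
    Partitional σ ∧ PersProfile μ₀ uR σ ρ ∧ x = U μ₀ uS σ ρ}

/-- The partitional cheap-talk payoff. -/
noncomputable def partCtPayoff (μ₀ : Ω → ℝ) (uS uR : A × Ω → ℝ) : ℝ :=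
  sSup {x | ∃ (σ : Ω → M → ℝ) (ρ : M → A → ℝ),
    Partitional σ ∧ CTEq μ₀ uS uR σ ρ ∧ x = U μ₀ uS σ ρ}

/-- A message is on-path if it is sent with positive probability in some state. -/
def OnPath (σ : Ω → M → ℝ) (m : M) : Prop := ∃ ω, 0 < σ ω m

/-- A pure action strategy: degenerate after every message. -/
def IsPureAct (ρ : M → A → ℝ) : Prop := ∀ m, ∃ a, ρ m a = 1

/-- A pure-on-path action strategy: degenerate after every on-path message. -/
def PureOnPath (σ : Ω → M → ℝ) (ρ : M → A → ℝ) : Prop :=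
  ∀ m, OnPath σ m → ∃ a, ρ m a = 1

/-- The posterior belief induced by message `m`. -/
noncomputable def post (μ₀ : Ω → ℝ) (σ : Ω → M → ℝ) (m : M) (ω : Ω) : ℝ :=
  μ₀ ω * σ ω m / ∑ ω', μ₀ ω' * σ ω' m

/-- The cube of environments `[0,1]^(2|A||Ω|)`. -/
def EnvCube (Ω A : Type) : Set ((A × Ω → ℝ) × (A × Ω → ℝ)) :=
  {e | (∀ p, e.1 p ∈ Set.Icc (0 : ℝ) 1) ∧ ∀ p, e.2 p ∈ Set.Icc (0 : ℝ) 1}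

/-- The cube of transparent environments `[0,1]^(|A|(|Ω|+1))`, points `(v, u_R)`. -/
def TransCube (Ω A : Type) : Set ((A → ℝ) × (A × Ω → ℝ)) :=
  {e | (∀ a, e.1 a ∈ Set.Icc (0 : ℝ) 1) ∧ ∀ p, e.2 p ∈ Set.Icc (0 : ℝ) 1}

open Classical in
/-- The expanded-indifference matrix `T^i`: rows `u_S(a_j,·) − u_S(a_i,·)` for `j ≠ i`,
rows `u_R(a_j,·) − u_R(a_i,·)` for `j ≠ i`, and the rows of the identity matrix. -/
noncomputable def TMat (uS uR : A × Ω → ℝ) (i : A) :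
    Matrix (({j : A // j ≠ i} ⊕ {j : A // j ≠ i}) ⊕ Ω) Ω ℝ :=
  Matrix.of fun r ω =>
    match r with
    | Sum.inl (Sum.inl j) => uS (j.1, ω) - uS (i, ω)
    | Sum.inl (Sum.inr j) => uR (j.1, ω) - uR (i, ω)
    | Sum.inr ω' => if ω' = ω then 1 else 0

/-- Scant indifferences: every row-submatrix of every expanded-indifference matrix has
full rank (rank equal to the minimum of the number of rows and the number of columns). -/
def ScantIndiff (uS uR : A × Ω → ℝ) : Prop :=
  ∀ i : A, ∀ s : Finset (({j : A // j ≠ i} ⊕ {j : A // j ≠ i}) ⊕ Ω),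
    ((TMat uS uR i).submatrix (fun r : {x // x ∈ s} => r.1) id).rank
      = min s.card (Fintype.card Ω)

open Classical in
/-- The set `Ω_a` of states in which `a` is an ideal action for Sender. -/
noncomputable def idealStates (uS : A × Ω → ℝ) (a : A) : Finset Ω :=
  Finset.univ.filter fun ω => ∀ b, uS (b, ω) ≤ uS (a, ω)

/-- Felicitous environment. -/
def Felicitous (μ₀ : Ω → ℝ) (uS uR : A × Ω → ℝ) : Prop :=
  ∀ a a' : A, 0 ≤ ∑ ω ∈ idealStates uS a, μ₀ ω * (uR (a, ω) - uR (a', ω))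

/-- Partitional-unique-response: for every nonempty subset of states, Receiver's
expected payoff has a unique maximizer. -/
def PUR (μ₀ : Ω → ℝ) (uR : A × Ω → ℝ) : Prop :=
  ∀ S : Finset Ω, S.Nonempty →
    ∃! a : A, ∀ b : A, ∑ ω ∈ S, μ₀ ω * uR (b, ω) ≤ ∑ ω ∈ S, μ₀ ω * uR (a, ω)

/-- Jointly-inclusive environment: each action is the unique ideal action of both
players in some state. -/
def JointlyInclusive (uS uR : A × Ω → ℝ) : Prop :=
  ∀ a : A, ∃ ω : Ω,
    (∀ b, b ≠ a → uS (b, ω) < uS (a, ω)) ∧ ∀ b, b ≠ a → uR (b, ω) < uR (a, ω)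

/-! ### Genericity -/

/-- Exceptional environments, cut off at size `n`. -/
def BadN (S : Finset Ω) (B : Finset A) (a₁ a₂ : A) (n : ℕ) :
    Set ((A × Ω → ℝ) × (A × Ω → ℝ)) :=
  {e | ∃ p : (A → ℝ) × (Ω → ℝ),
    p ∈ Metric.closedBall (0 : A → ℝ) n ×ˢ Metric.sphere (0 : Ω → ℝ) 1 ∧
    (∀ ω ∈ S, e.1 (a₁, ω) - e.1 (a₂, ω) = ∑ b ∈ B, p.1 b * (e.2 (b, ω) - e.2 (a₁, ω))) ∧
    (∀ ω, ω ∉ S → p.2 ω = 0) ∧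
    ∀ b ∈ B, ∑ ω, p.2 ω * (e.2 (b, ω) - e.2 (a₁, ω)) = 0}

lemma isClosed_BadN (S : Finset Ω) (B : Finset A) (a₁ a₂ : A) (n : ℕ) :
    IsClosed (BadN S B a₁ a₂ n) := by
  set K : Set ((A → ℝ) × (Ω → ℝ)) :=
    Metric.closedBall (0 : A → ℝ) n ×ˢ Metric.sphere (0 : Ω → ℝ) 1 with hK
  have hKc : IsCompact K := (isCompact_closedBall _ _).prod (isCompact_sphere _ _)
  have : CompactSpace K := isCompact_iff_compactSpace.1 hKc
  have hZ : IsClosed {q : ((A × Ω → ℝ) × (A × Ω → ℝ)) × K |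
      (∀ ω ∈ S, q.1.1 (a₁, ω) - q.1.1 (a₂, ω)
        = ∑ b ∈ B, q.2.1.1 b * (q.1.2 (b, ω) - q.1.2 (a₁, ω))) ∧
      (∀ ω, ω ∉ S → q.2.1.2 ω = 0) ∧
      ∀ b ∈ B, ∑ ω, q.2.1.2 ω * (q.1.2 (b, ω) - q.1.2 (a₁, ω)) = 0} := by
    simp only [Set.ofPred_and, Set.ofPred_forall]
    refine IsClosed.inter ?_ (IsClosed.inter ?_ ?_)
    · exact isClosed_iInter fun ω => isClosed_iInter fun _ =>
        isClosed_eq (by fun_prop) (by fun_prop)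
    · exact isClosed_iInter fun ω => isClosed_iInter fun _ =>
        isClosed_eq (by fun_prop) (by fun_prop)
    · exact isClosed_iInter fun ω => isClosed_iInter fun _ =>
        isClosed_eq (by fun_prop) (by fun_prop)
  have := isClosedMap_fst_of_compactSpace _ hZ
  convert this using 1
  ext e
  constructor
  · rintro ⟨p, hp, h⟩
    exact ⟨(e, ⟨p, hp⟩), h, rfl⟩
  · rintro ⟨⟨e', p⟩, h, rfl⟩
    exact ⟨p.1, p.2, h⟩

lemma volume_BadN (S : Finset Ω) (B : Finset A) {a₁ a₂ : A} (h12 : a₁ ≠ a₂) (n : ℕ) :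
    volume (BadN S B a₁ a₂ n) = 0 := by
  classical
  rw [Measure.volume_eq_prod, Measure.prod_apply_symm (isClosed_BadN S B a₁ a₂ n).measurableSet]
  rw [lintegral_eq_zero_of_ae_eq_zero]
  refine Filter.Eventually.of_forall fun r => ?_
  by_cases hne : ((fun x => (x, r)) ⁻¹' BadN S B a₁ a₂ n).Nonempty
  swap
  · rw [Set.not_nonempty_iff_eq_empty] at hne
    simp [hne]
  obtain ⟨s₀, ⟨c₀, y⟩, hp, -, hy0, hyB⟩ := hne
  simp only [Set.mem_prod, mem_sphere_iff_norm, sub_zero] at hp hy0 hyB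
  let L : (A × Ω → ℝ) →ₗ[ℝ] ℝ :=
    ∑ ω, y ω • (LinearMap.proj (R := ℝ) (φ := fun _ : A × Ω => ℝ) (a₁, ω) -
      LinearMap.proj (R := ℝ) (φ := fun _ : A × Ω => ℝ) (a₂, ω))
  have hL : ∀ s, L s = ∑ ω, y ω * (s (a₁, ω) - s (a₂, ω)) := by
    intro s; simp [L, LinearMap.sum_apply]
  have hker : LinearMap.ker L ≠ ⊤ := by
    intro htop
    have hy : y = 0 := by
      funext ω
      have h1 : Pi.single (a₁, ω) (1 : ℝ) ∈ LinearMap.ker L := htop ▸ Submodule.mem_top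
      rw [LinearMap.mem_ker, hL] at h1
      simpa [Pi.single_apply, h12, h12.symm] using h1
    rw [hy] at hp
    simp at hp
  refine measure_mono_null ?_ (Measure.addHaar_submodule volume (LinearMap.ker L) hker)
  rintro s ⟨⟨c, y'⟩, -, hc, -, -⟩
  simp only at hc
  simp only [SetLike.mem_coe, LinearMap.mem_ker, hL]
  calc ∑ ω, y ω * (s (a₁, ω) - s (a₂, ω))
      = ∑ ω, y ω * ∑ b ∈ B, c b * (r (b, ω) - r (a₁, ω)) := by
        refine Finset.sum_congr rfl fun ω _ => ?_
        by_cases hω : ω ∈ S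
        · rw [hc ω hω]
        · rw [hy0 ω hω]; simp
    _ = ∑ b ∈ B, c b * ∑ ω, y ω * (r (b, ω) - r (a₁, ω)) := by
        simp only [Finset.mul_sum]
        rw [Finset.sum_comm]
        refine Finset.sum_congr rfl fun b _ => Finset.sum_congr rfl fun ω _ => by ring
    _ = 0 := Finset.sum_eq_zero fun b hb => by rw [hyB b hb, mul_zero]

/-- The generic condition. -/
def Good (e : (A × Ω → ℝ) × (A × Ω → ℝ)) : Prop :=
  ∀ (S : Finset Ω) (B : Finset A) (a₁ a₂ : A), a₁ ≠ a₂ → ∀ n : ℕ, e ∉ BadN S B a₁ a₂ n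

lemma volume_not_good : volume {e : (A × Ω → ℝ) × (A × Ω → ℝ) | ¬ Good e} = 0 := by
  have : {e : (A × Ω → ℝ) × (A × Ω → ℝ) | ¬ Good e} ⊆
      ⋃ S : Finset Ω, ⋃ B : Finset A, ⋃ a₁ : A, ⋃ a₂ : A, ⋃ _ : a₁ ≠ a₂, ⋃ n : ℕ,
        BadN S B a₁ a₂ n := by
    intro e he
    simp only [Good, Set.mem_ofPred_eq] at he
    push Not at he
    simpa only [Set.mem_iUnion, exists_prop] using he
  refine measure_mono_null this ?_
  have : Countable A := Finite.to_countable
  have : Countable Ω := Finite.to_countable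
  simp only [measure_iUnion_null_iff]
  intro S B a₁ a₂ h n
  exact volume_BadN S B h n

/-- Use of the generic condition: a direction orthogonal to Receiver's ties that Sender likes. -/
lemma Good.exists_dir {uS uR : A × Ω → ℝ} (h : Good (uS, uR)) (S : Finset Ω) (B : Finset A)
    {a₁ a₂ : A} (h12 : a₁ ≠ a₂) (y : Ω → ℝ) (hy : y ≠ 0) (hy0 : ∀ ω, ω ∉ S → y ω = 0)
    (hyB : ∀ b ∈ B, ∑ ω, y ω * (uR (b, ω) - uR (a₁, ω)) = 0) :
    ∃ d : Ω → ℝ, (∀ ω, ω ∉ S → d ω = 0) ∧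
      (∀ b ∈ B, ∑ ω, d ω * (uR (b, ω) - uR (a₁, ω)) = 0) ∧
      0 < ∑ ω, d ω * (uS (a₁, ω) - uS (a₂, ω)) := by
  classical
  let w : A → Ω → ℝ := fun b ω => if b ∈ B ∧ ω ∈ S then uR (b, ω) - uR (a₁, ω) else 0
  let f : Ω → ℝ := fun ω => if ω ∈ S then uS (a₁, ω) - uS (a₂, ω) else 0
  let T : (A → ℝ) →ₗ[ℝ] (Ω → ℝ) := ∑ b, (LinearMap.proj b).smulRight (w b)
  have hT : ∀ c ω, T c ω = ∑ b, c b * w b ω := by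
    intro c ω; simp [T, LinearMap.sum_apply]
  have hf : f ∉ LinearMap.range T := by
    rintro ⟨c, hc⟩
    have hny : 0 < ‖y‖ := norm_pos_iff.2 hy
    obtain ⟨n, hn⟩ := exists_nat_ge ‖c‖
    refine h S B a₁ a₂ h12 n ⟨(c, ‖y‖⁻¹ • y), ⟨?_, ?_⟩, ?_, ?_, ?_⟩
    · simpa using hn
    · simp [norm_smul, hny.ne']
    · intro ω hω
      have := congrFun hc ω
      rw [hT] at this
      simp only [f, w, hω, and_true, if_true] at this
      rw [← this]
      simp
    · intro ω hω
      simp [hy0 ω hω]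
    · intro b hb
      have := hyB b hb
      simp only [Pi.smul_apply, smul_eq_mul, mul_assoc]
      rw [← Finset.mul_sum, this, mul_zero]
  obtain ⟨φ, hφf, hφ⟩ := Submodule.exists_le_ker_of_notMem hf
  have hφs : ∀ v : Ω → ℝ, φ v = ∑ ω, φ (Pi.single ω 1) * v ω := by
    intro v
    conv_lhs => rw [LinearMap.pi_apply_eq_sum_univ φ v]
    refine Finset.sum_congr rfl fun ω _ => ?_
    rw [smul_eq_mul, mul_comm]
    congr 2
    funext j
    simp [Pi.single_apply, eq_comm]
  let d₀ : Ω → ℝ := fun ω => if ω ∈ S then φ (Pi.single ω 1) else 0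
  have hd0 : ∀ ω, ω ∉ S → d₀ ω = 0 := fun ω hω => by simp [d₀, hω]
  have hdB : ∀ b ∈ B, ∑ ω, d₀ ω * (uR (b, ω) - uR (a₁, ω)) = 0 := by
    intro b hb
    have h1 : φ (w b) = 0 := by
      have : w b ∈ LinearMap.range T := ⟨Pi.single b 1, by
        funext ω; rw [hT]; simp [Pi.single_apply]⟩
      exact hφ this
    rw [hφs] at h1
    rw [← h1]
    refine Finset.sum_congr rfl fun ω _ => ?_
    by_cases hω : ω ∈ S <;> simp [d₀, w, hω, hb]
  have hdf : ∑ ω, d₀ ω * (uS (a₁, ω) - uS (a₂, ω)) ≠ 0 := by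
    rw [hφs] at hφf
    convert hφf using 1
    refine Finset.sum_congr rfl fun ω _ => ?_
    by_cases hω : ω ∈ S <;> simp [d₀, f, hω]
  rcases lt_or_gt_of_ne hdf with hlt | hgt
  · refine ⟨fun ω => - d₀ ω, fun ω hω => by simp [hd0 ω hω], fun b hb => ?_, ?_⟩
    · simp only [neg_mul, Finset.sum_neg_distrib, hdB b hb, neg_zero]
    · simp only [neg_mul, Finset.sum_neg_distrib]; linarith
  · exact ⟨d₀, hd0, hdB, hgt⟩

lemma Good.ne {uS uR : A × Ω → ℝ} (h : Good (uS, uR)) {a₁ a₂ : A} (h12 : a₁ ≠ a₂) (ω : Ω) :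
    uS (a₁, ω) ≠ uS (a₂, ω) := by
  classical
  intro heq
  obtain ⟨d, hd, -, hpos⟩ := h.exists_dir {ω} ∅ h12 (Pi.single ω 1)
    (fun h0 => by simpa using congrFun h0 ω)
    (fun ω' hω' => by
      have : ω' ≠ ω := by simpa using hω'
      simp [this]) (by simp)
  rw [Finset.sum_eq_zero] at hpos
  · exact lt_irrefl _ hpos
  · intro ω' _
    by_cases h' : ω' = ω
    · subst h'; rw [heq]; ring
    · rw [hd ω' (by simpa using h')]; ring

/-! ### Best responses -/

/-- Maximization of a linear functional over families of distributions. -/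
lemma best_iff {I X : Type} [Fintype I] [Fintype X] (w : I → X → ℝ) (f : I → X → ℝ)
    (hf : ∀ i, IsDist (f i)) :
    (∀ g : I → X → ℝ, (∀ i, IsDist (g i)) → ∑ i, ∑ x, g i x * w i x ≤ ∑ i, ∑ x, f i x * w i x) ↔
    ∀ i a b, 0 < f i a → w i b ≤ w i a := by
  classical
  constructor
  · intro h i a b hpos
    by_cases hab : a = b
    · rw [hab]
    let g : I → X → ℝ := fun j x => f j x +
      if j = i then f i a * ((if x = b then 1 else 0) - (if x = a then 1 else 0)) else 0
    have hg : ∀ j, IsDist (g j) := by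
      intro j
      by_cases hj : j = i
      · subst hj
        refine ⟨fun x => ?_, ?_⟩
        · have := (hf j).1 x
          simp only [g, if_true]
          by_cases hxa : x = a
          · subst hxa; simp [hab]
          · by_cases hxb : x = b
            · subst hxb; simp [hxa]; linarith
            · simp [hxa, hxb, this]
        · simp only [g, if_true, Finset.sum_add_distrib, ← Finset.mul_sum, Finset.sum_sub_distrib]
          simp [(hf j).2]
      · have : g j = f j := by funext x; simp [g, hj]
        rw [this]; exact hf j
    have h1 := h g hg
    have h2 : ∑ j, ∑ x, g j x * w j x = ∑ j, ∑ x, f j x * w j x + f i a * (w i b - w i a) := by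
      simp only [g, add_mul, Finset.sum_add_distrib]
      congr 1
      simp [ite_mul, sub_mul, mul_sub, Finset.sum_sub_distrib, Finset.sum_ite_irrel]
    rw [h2] at h1
    by_contra hlt
    push Not at hlt
    have := mul_pos hpos (sub_pos.2 hlt)
    linarith
  · intro h g hg
    refine Finset.sum_le_sum fun i _ => ?_
    have hex : ∃ a, 0 < f i a := by
      by_contra hno
      push Not at hno
      have := Finset.sum_nonpos (s := Finset.univ) fun x _ => hno x
      rw [(hf i).2] at this
      linarith
    obtain ⟨a, ha⟩ := hex
    have h1 : ∑ x, f i x * w i x = w i a := by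
      have : ∀ x ∈ Finset.univ, f i x * w i x = f i x * w i a := by
        intro x _
        rcases ((hf i).1 x).eq_or_lt with h0 | h0
        · rw [← h0]; simp
        · rw [le_antisymm (h i a x ha) (h i x a h0)]
      rw [Finset.sum_congr rfl this, ← Finset.sum_mul, (hf i).2, one_mul]
    have h2 : ∑ x, g i x * w i x ≤ ∑ x, g i x * w i a :=
      Finset.sum_le_sum fun x _ => mul_le_mul_of_nonneg_left (h i a x ha) ((hg i).1 x)
    rw [← Finset.sum_mul, (hg i).2, one_mul] at h2
    linarith

lemma exists_pos_of_isDist {X : Type} [Fintype X] {f : X → ℝ} (hf : IsDist f) :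
    ∃ a, 0 < f a := by
  by_contra hno
  push Not at hno
  have := Finset.sum_nonpos (s := Finset.univ) fun x _ => hno x
  rw [hf.2] at this
  linarith

lemma U_eq_sender (μ₀ : Ω → ℝ) (u : A × Ω → ℝ) (σ : Ω → M → ℝ) (ρ : M → A → ℝ) :
    U μ₀ u σ ρ = ∑ ω, ∑ m, σ ω m * (μ₀ ω * ∑ a, ρ m a * u (a, ω)) := by
  unfold U
  refine Finset.sum_congr rfl fun ω _ => Finset.sum_congr rfl fun m _ => ?_
  simp only [Finset.mul_sum]
  exact Finset.sum_congr rfl fun a _ => by ring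

lemma U_eq_receiver (μ₀ : Ω → ℝ) (u : A × Ω → ℝ) (σ : Ω → M → ℝ) (ρ : M → A → ℝ) :
    U μ₀ u σ ρ = ∑ m, ∑ a, ρ m a * ∑ ω, μ₀ ω * σ ω m * u (a, ω) := by
  unfold U
  rw [Finset.sum_comm]
  refine Finset.sum_congr rfl fun m _ => ?_
  rw [Finset.sum_comm]
  refine Finset.sum_congr rfl fun a _ => ?_
  rw [Finset.mul_sum]
  exact Finset.sum_congr rfl fun a _ => by ring

lemma RBR_iff (μ₀ : Ω → ℝ) (uR : A × Ω → ℝ) (σ : Ω → M → ℝ) (ρ : M → A → ℝ) (hρ : IsAct ρ) :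
    RBR μ₀ uR σ ρ ↔ ∀ m a b, 0 < ρ m a →
      0 ≤ ∑ ω, μ₀ ω * σ ω m * (uR (a, ω) - uR (b, ω)) := by
  unfold RBR
  simp only [U_eq_receiver]
  rw [show (∀ ρ' : M → A → ℝ, IsAct ρ' → _) ↔ _ from
    best_iff (fun m a => ∑ ω, μ₀ ω * σ ω m * uR (a, ω)) ρ hρ]
  simp only [mul_sub, Finset.sum_sub_distrib, sub_nonneg]

lemma SBR_iff (μ₀ : Ω → ℝ) (hμ : IsPrior μ₀) (uS : A × Ω → ℝ) (σ : Ω → M → ℝ) (ρ : M → A → ℝ)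
    (hσ : IsMsg σ) :
    SBR μ₀ uS σ ρ ↔ ∀ ω m m', 0 < σ ω m →
      ∑ a, ρ m' a * uS (a, ω) ≤ ∑ a, ρ m a * uS (a, ω) := by
  unfold SBR
  simp only [U_eq_sender]
  rw [show (∀ σ' : Ω → M → ℝ, IsMsg σ' → _) ↔ _ from
    best_iff (fun ω m => μ₀ ω * ∑ a, ρ m a * uS (a, ω)) σ hσ]
  refine forall_congr' fun ω => ?_
  simp only [mul_le_mul_iff_right₀ (hμ.1 ω)]

/-! ### Compactness -/

lemma continuous_U (μ₀ : Ω → ℝ) (u : A × Ω → ℝ) :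
    Continuous fun p : (Ω → M → ℝ) × (M → A → ℝ) => U μ₀ u p.1 p.2 := by
  unfold U
  fun_prop

lemma isCompact_isDist {X : Type} [Fintype X] : IsCompact {f : X → ℝ | IsDist f} :=
  isCompact_stdSimplex ℝ X

lemma isCompact_family {I X : Type} [Fintype X] :
    IsCompact {f : I → X → ℝ | ∀ i, IsDist (f i)} := by
  have := isCompact_univ_pi (X := fun _ : I => X → ℝ) fun _ : I => isCompact_isDist (X := X)
  convert this using 1
  ext f
  simp

lemma isCompact_strat {Ω A M : Type} [Fintype A] [Fintype M] :
    IsCompact {p : (Ω → M → ℝ) × (M → A → ℝ) | IsMsg p.1 ∧ IsAct p.2} :=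
  (isCompact_family (I := Ω) (X := M)).prod (isCompact_family (I := M) (X := A))

lemma isCompact_CTEq (μ₀ : Ω → ℝ) (uS uR : A × Ω → ℝ) :
    IsCompact {p : (Ω → M → ℝ) × (M → A → ℝ) | CTEq μ₀ uS uR p.1 p.2} := by
  have h1 : IsClosed {p : (Ω → M → ℝ) × (M → A → ℝ) | SBR μ₀ uS p.1 p.2} := by
    unfold SBR
    simp only [Set.ofPred_forall]
    refine isClosed_iInter fun σ' => isClosed_iInter fun _ => isClosed_le ?_ (continuous_U μ₀ uS)
    unfold U
    fun_prop
  have h2 : IsClosed {p : (Ω → M → ℝ) × (M → A → ℝ) | RBR μ₀ uR p.1 p.2} := by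
    unfold RBR
    simp only [Set.ofPred_forall]
    refine isClosed_iInter fun σ' => isClosed_iInter fun _ => isClosed_le ?_ (continuous_U μ₀ uR)
    unfold U
    fun_prop
  have := isCompact_strat (Ω := Ω) (M := M) (A := A) |>.inter_right (h1.inter h2)
  convert this using 1
  ext p
  simp only [CTEq, Set.mem_ofPred_eq, Set.mem_inter_iff, and_assoc]

lemma bddAbove_pers (μ₀ : Ω → ℝ) (uS uR : A × Ω → ℝ) :
    BddAbove {x | ∃ (σ : Ω → M → ℝ) (ρ : M → A → ℝ),
      PersProfile μ₀ uR σ ρ ∧ x = U μ₀ uS σ ρ} := by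
  refine ((isCompact_strat (Ω := Ω) (M := M) (A := A)).image
    (continuous_U μ₀ uS)).bddAbove.mono ?_
  rintro x ⟨σ, ρ, h, rfl⟩
  exact ⟨(σ, ρ), ⟨h.1, h.2.1⟩, rfl⟩

/-! ### The linear program -/

lemma obedient_le (hMA : Fintype.card A ≤ Fintype.card M) [Nonempty A]
    (μ₀ : Ω → ℝ) (hμ : IsPrior μ₀) (uS uR : A × Ω → ℝ) (x : A → Ω → ℝ)
    (hx : ∀ a ω, 0 ≤ x a ω) (hsum : ∀ ω, ∑ a, x a ω = μ₀ ω)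
    (hob : ∀ a b, 0 ≤ ∑ ω, x a ω * (uR (a, ω) - uR (b, ω))) :
    ∑ ω, ∑ a, x a ω * uS (a, ω) ≤ persPayoff (M := M) μ₀ uS uR := by
  classical
  obtain ⟨f⟩ := Function.Embedding.nonempty_of_card_le hMA
  let g : M → A := Function.invFun f
  have hgf : ∀ a, g (f a) = a := Function.leftInverse_invFun f.injective
  let σ : Ω → M → ℝ := fun ω m => ∑ a, if f a = m then x a ω / μ₀ ω else 0
  let ρ : M → A → ℝ := fun m a => if a = g m then 1 else 0
  have hμσ : ∀ ω m, μ₀ ω * σ ω m = ∑ a, if f a = m then x a ω else 0 := by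
    intro ω m
    simp only [σ, Finset.mul_sum]
    refine Finset.sum_congr rfl fun a _ => ?_
    have := (hμ.1 ω).ne'
    split_ifs
    · field_simp
    · simp
  have hσ : IsMsg σ := by
    intro ω
    refine ⟨fun m => Finset.sum_nonneg fun a _ => ?_, ?_⟩
    · split_ifs
      · exact div_nonneg (hx a ω) (hμ.1 ω).le
      · exact le_rfl
    · simp only [σ]
      rw [Finset.sum_comm]
      simp only [Finset.sum_ite_eq, Finset.mem_univ, if_true]
      rw [← Finset.sum_div, hsum, div_self (hμ.1 ω).ne']
  have hρ : IsAct ρ := by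
    intro m
    refine ⟨fun a => ?_, ?_⟩
    · simp only [ρ]; split_ifs <;> norm_num
    · simp [ρ]
  refine le_csSup (bddAbove_pers μ₀ uS uR) ⟨σ, ρ, ⟨hσ, hρ, ?_⟩, ?_⟩
  · rw [RBR_iff _ _ _ _ hρ]
    intro m a b hpos
    have ha : a = g m := by
      by_contra hne
      simp [ρ, hne] at hpos
    simp only [hμσ]
    by_cases hm : ∃ a', f a' = m
    · obtain ⟨a', rfl⟩ := hm
      rw [hgf] at ha
      subst ha
      simpa [f.injective.eq_iff] using hob a b
    · push Not at hm
      simp [hm]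
  · simp only [U, hμσ, ρ]
    refine Finset.sum_congr rfl fun ω _ => ?_
    simp only [mul_ite, mul_one, mul_zero, ite_mul, zero_mul, Finset.sum_ite_eq', Finset.mem_univ,
      if_true, Finset.sum_mul]
    rw [Finset.sum_comm]
    simp [hgf]

lemma eventually_small {s t : ℝ} (hs : 0 < s) :
    ∀ᶠ ε in nhdsWithin (0 : ℝ) (Set.Ioi 0), 0 ≤ s + ε * t := by
  have hc : Continuous fun ε : ℝ => s + ε * t := by fun_prop
  have h1 : Filter.Tendsto (fun ε : ℝ => s + ε * t) (nhds 0) (nhds s) := by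
    simpa using hc.tendsto 0
  exact ((h1.mono_left nhdsWithin_le_nhds).eventually (lt_mem_nhds hs)).mono fun _ h => h.le

/-- In a good environment, Receiver does not mix on path at a persuasion-optimal profile. -/
lemma pure_of_optimal (hMA : Fintype.card A ≤ Fintype.card M) [Nonempty A]
    (μ₀ : Ω → ℝ) (hμ : IsPrior μ₀) {uS uR : A × Ω → ℝ} (hgood : Good (uS, uR))
    (σ : Ω → M → ℝ) (ρ : M → A → ℝ) (hσ : IsMsg σ) (hρ : IsAct ρ) (hR : RBR μ₀ uR σ ρ)
    (hopt : persPayoff (M := M) μ₀ uS uR ≤ U μ₀ uS σ ρ)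
    (m : M) (ω₀ : Ω) (hm : 0 < σ ω₀ m) (a₁ a₂ : A) (h1 : 0 < ρ m a₁) (h2 : 0 < ρ m a₂) :
    a₁ = a₂ := by
  classical
  by_contra h12
  rw [RBR_iff _ _ _ _ hρ] at hR
  let y : Ω → ℝ := fun ω => μ₀ ω * σ ω m
  let S : Finset Ω := Finset.univ.filter fun ω => 0 < y ω
  let B : Finset A := Finset.univ.filter fun b => ∑ ω, y ω * (uR (b, ω) - uR (a₁, ω)) = 0
  have hy0 : ∀ ω, 0 ≤ y ω := fun ω => mul_nonneg (hμ.1 ω).le ((hσ ω).1 m)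
  have hyne : y ≠ 0 := fun h => (mul_pos (hμ.1 ω₀) hm).ne' (congrFun h ω₀)
  obtain ⟨d, hdS, hdB, hdpos⟩ := hgood.exists_dir S B h12 y hyne
    (fun ω hω => by
      simp only [S, Finset.mem_filter, Finset.mem_univ, true_and, not_lt] at hω
      exact le_antisymm hω (hy0 ω))
    (fun b hb => by simpa [B] using hb)
  -- the induced outcome
  let x : A → Ω → ℝ := fun a ω => ∑ m', ρ m' a * (μ₀ ω * σ ω m')
  have hterm : ∀ a ω m', 0 ≤ ρ m' a * (μ₀ ω * σ ω m') := fun a ω m' =>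
    mul_nonneg ((hρ m').1 a) (mul_nonneg (hμ.1 ω).le ((hσ ω).1 m'))
  have hxge : ∀ a ω, ρ m a * y ω ≤ x a ω := fun a ω =>
    Finset.single_le_sum (f := fun m' => ρ m' a * (μ₀ ω * σ ω m')) (fun m' _ => hterm a ω m')
      (Finset.mem_univ m)
  have hxsum : ∀ ω, ∑ a, x a ω = μ₀ ω := by
    intro ω
    simp only [x]
    rw [Finset.sum_comm]
    simp only [← Finset.sum_mul, (hρ _).2, one_mul]
    rw [← Finset.mul_sum, (hσ ω).2, mul_one]
  have hxob : ∀ a b, ρ m a * ∑ ω, y ω * (uR (a, ω) - uR (b, ω)) ≤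
      ∑ ω, x a ω * (uR (a, ω) - uR (b, ω)) := by
    intro a b
    have : ∑ ω, x a ω * (uR (a, ω) - uR (b, ω)) =
        ∑ m', ρ m' a * ∑ ω, μ₀ ω * σ ω m' * (uR (a, ω) - uR (b, ω)) := by
      simp only [x, Finset.sum_mul, Finset.mul_sum]
      rw [Finset.sum_comm]
      exact Finset.sum_congr rfl fun _ _ => Finset.sum_congr rfl fun _ _ => by ring
    rw [this]
    refine Finset.single_le_sum
      (f := fun m' => ρ m' a * ∑ ω, μ₀ ω * σ ω m' * (uR (a, ω) - uR (b, ω)))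
      (fun m' _ => ?_) (Finset.mem_univ m)
    rcases ((hρ m').1 a).eq_or_lt with h0 | h0
    · rw [← h0]; simp
    · exact mul_nonneg h0.le (hR m' a b h0)
  have hyob : ∀ a b, 0 < ρ m a → 0 ≤ ∑ ω, y ω * (uR (a, ω) - uR (b, ω)) :=
    fun a b h => hR m a b h
  have hxob0 : ∀ a b, 0 ≤ ∑ ω, x a ω * (uR (a, ω) - uR (b, ω)) := by
    intro a b
    refine le_trans ?_ (hxob a b)
    rcases ((hρ m).1 a).eq_or_lt with h0 | h0
    · rw [← h0]; simp
    · exact mul_nonneg h0.le (hyob a b h0)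
  -- both actions are optimal at `m`, so they tie
  have hsplit : ∀ (z : Ω → ℝ) (a b c : A), ∑ ω, z ω * (uR (a, ω) - uR (b, ω)) =
      ∑ ω, z ω * (uR (a, ω) - uR (c, ω)) - ∑ ω, z ω * (uR (b, ω) - uR (c, ω)) := by
    intro z a b c
    rw [← Finset.sum_sub_distrib]
    exact Finset.sum_congr rfl fun _ _ => by ring
  have hself : ∀ (z : Ω → ℝ) (a : A), ∑ ω, z ω * (uR (a, ω) - uR (a, ω)) = 0 := by
    intro z a; simp
  have hB1 : a₁ ∈ B := by simp [B]
  have hB2 : a₂ ∈ B := by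
    simp only [B, Finset.mem_filter, Finset.mem_univ, true_and]
    have e1 := hyob a₁ a₂ h1
    have e2 := hyob a₂ a₁ h2
    rw [hsplit y a₁ a₂ a₁, hself] at e1
    linarith
  have hyB : ∀ b ∈ B, ∑ ω, y ω * (uR (b, ω) - uR (a₁, ω)) = 0 := fun b hb => by
    simpa [B] using hb
  -- tie or strict
  have hkey : ∀ a ∈ B, 0 < ρ m a → ∀ b, 
      ∑ ω, d ω * (uR (a, ω) - uR (b, ω)) = 0 ∨ 0 < ∑ ω, x a ω * (uR (a, ω) - uR (b, ω)) := by
    intro a ha hpos b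
    by_cases hb : b ∈ B
    · left
      rw [hsplit d a b a₁, hdB a ha, hdB b hb, sub_zero]
    · right
      refine lt_of_lt_of_le (mul_pos hpos ?_) (hxob a b)
      refine lt_of_le_of_ne (hyob a b hpos) fun h0 => hb ?_
      simp only [B, Finset.mem_filter, Finset.mem_univ, true_and]
      have := hsplit y a b a₁
      rw [hyB a ha, ← h0] at this
      linarith
  -- small enough perturbation
  have hev : ∀ a ∈ B, 0 < ρ m a → ∀ s : ℝ, ∀ᶠ ε in nhdsWithin (0 : ℝ) (Set.Ioi 0),
      (∀ ω, 0 ≤ x a ω + ε * (s * d ω)) ∧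
      ∀ b, 0 ≤ ∑ ω, (x a ω + ε * (s * d ω)) * (uR (a, ω) - uR (b, ω)) := by
    intro a ha hpos s
    refine Filter.Eventually.and ?_ ?_
    · rw [Filter.eventually_all]
      intro ω
      by_cases hω : ω ∈ S
      · have hyω : 0 < y ω := by simpa [S] using hω
        exact eventually_small (lt_of_lt_of_le (mul_pos hpos hyω) (hxge a ω))
      · refine Filter.Eventually.of_forall fun ε => ?_
        rw [hdS ω hω]
        simpa using Finset.sum_nonneg fun m' _ => hterm a ω m'
    · rw [Filter.eventually_all]
      intro b
      have hexp : ∀ ε : ℝ, ∑ ω, (x a ω + ε * (s * d ω)) * (uR (a, ω) - uR (b, ω)) =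
          ∑ ω, x a ω * (uR (a, ω) - uR (b, ω)) +
            ε * (s * ∑ ω, d ω * (uR (a, ω) - uR (b, ω))) := by
        intro ε
        simp only [Finset.mul_sum, ← Finset.sum_add_distrib]
        exact Finset.sum_congr rfl fun _ _ => by ring
      simp only [hexp]
      rcases hkey a ha hpos b with h0 | h0
      · refine Filter.Eventually.of_forall fun ε => ?_
        rw [h0]
        simpa using hxob0 a b
      · exact eventually_small h0
  obtain ⟨ε, ⟨he1, he2⟩, hε⟩ :=
    (((hev a₁ hB1 h1 1).and (hev a₂ hB2 h2 (-1))).and self_mem_nhdsWithin).exists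
  have hε : 0 < ε := hε
  let s : A → ℝ := fun a => (if a = a₁ then 1 else 0) + (if a = a₂ then -1 else 0)
  have hs1 : s a₁ = 1 := by simp [s, h12]
  have hs2 : s a₂ = -1 := by simp [s, Ne.symm h12]
  have hs0 : ∀ a, a ≠ a₁ → a ≠ a₂ → s a = 0 := fun a h h' => by simp [s, h, h']
  have hle := obedient_le (M := M) hMA μ₀ hμ uS uR (fun a ω => x a ω + ε * (s a * d ω)) ?_ ?_ ?_
  · have hU : U μ₀ uS σ ρ = ∑ ω, ∑ a, x a ω * uS (a, ω) := by
      simp only [U, x, Finset.sum_mul]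
      refine Finset.sum_congr rfl fun ω _ => ?_
      rw [Finset.sum_comm]
      exact Finset.sum_congr rfl fun _ _ => Finset.sum_congr rfl fun _ _ => by ring
    have hnew : ∑ ω, ∑ a, (x a ω + ε * (s a * d ω)) * uS (a, ω) =
        ∑ ω, ∑ a, x a ω * uS (a, ω) + ε * ∑ ω, d ω * (uS (a₁, ω) - uS (a₂, ω)) := by
      rw [Finset.mul_sum, ← Finset.sum_add_distrib]
      refine Finset.sum_congr rfl fun ω _ => ?_
      simp only [add_mul, Finset.sum_add_distrib]
      congr 1
      simp only [s, add_mul, mul_add, ite_mul, mul_ite, one_mul, zero_mul, mul_zero,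
        Finset.sum_add_distrib, Finset.sum_ite_eq', Finset.mem_univ, if_true]
      ring
    rw [hnew, ← hU] at hle
    have := mul_pos hε hdpos
    linarith
  · intro a ω
    by_cases e1 : a = a₁
    · subst e1; rw [hs1]; exact he1.1 ω
    by_cases e2 : a = a₂
    · subst e2; rw [hs2]; exact he2.1 ω
    rw [hs0 a e1 e2]
    simpa using Finset.sum_nonneg fun m' _ => hterm a ω m'
  · intro ω
    rw [Finset.sum_add_distrib, hxsum, ← Finset.mul_sum, ← Finset.sum_mul]
    simp [s, Finset.sum_add_distrib]
  · intro a b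
    by_cases e1 : a = a₁
    · subst e1; rw [hs1]; exact he1.2 b
    by_cases e2 : a = a₂
    · subst e2; rw [hs2]; exact he2.2 b
    rw [hs0 a e1 e2]
    simpa using hxob0 a b

/-! ### Partitional equilibrium -/

lemma exists_partitional [Nonempty Ω] (μ₀ : Ω → ℝ) (hμ : IsPrior μ₀) {uS uR : A × Ω → ℝ}
    (hne : ∀ a b ω, a ≠ b → uS (a, ω) ≠ uS (b, ω))
    (σ : Ω → M → ℝ) (ρ : M → A → ℝ) (h : CTEq μ₀ uS uR σ ρ)
    (hpure : ∀ m ω, 0 < σ ω m → ∀ a b, 0 < ρ m a → 0 < ρ m b → a = b) :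
    ∃ σ' : Ω → M → ℝ, Partitional σ' ∧ CTEq μ₀ uS uR σ' ρ ∧ U μ₀ uS σ ρ ≤ U μ₀ uS σ' ρ := by
  classical
  obtain ⟨hσ, hρ, hS, hR⟩ := h
  rw [SBR_iff _ hμ _ _ _ hσ] at hS
  rw [RBR_iff _ _ _ _ hρ] at hR
  choose α hα using fun m => exists_pos_of_isDist (hρ m)
  choose k hk using fun ω => exists_pos_of_isDist (hσ ω)
  -- payoff of an on-path message
  have hval : ∀ m ω, 0 < σ ω m → ∀ ω', ∑ a, ρ m a * uS (a, ω') = uS (α m, ω') := by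
    intro m ω hm ω'
    have hz : ∀ a, a ≠ α m → ρ m a = 0 := by
      intro a ha
      by_contra h0
      exact ha (hpure m ω hm a (α m) (lt_of_le_of_ne ((hρ m).1 a) (Ne.symm h0)) (hα m))
    have h1 : ρ m (α m) = 1 := by
      rw [← (hρ m).2]
      exact (Finset.sum_eq_single _ (fun a _ ha => hz a ha) (by simp)).symm
    rw [Finset.sum_eq_single (α m) (fun a _ ha => by rw [hz a ha, zero_mul]) (by simp), h1, one_mul]
  have huniq : ∀ m ω, 0 < σ ω m → α m = α (k ω) := by
    intro m ω hm
    by_contra hcon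
    refine hne _ _ ω hcon ?_
    rw [← hval m ω hm ω, ← hval (k ω) ω (hk ω) ω]
    exact le_antisymm (hS ω _ _ (hk ω)) (hS ω _ _ hm)
  -- canonical messages
  have hrep : ∃ rep : A → M, ∀ ω, (∃ ω', 0 < σ ω' (rep (α (k ω)))) ∧
      α (rep (α (k ω))) = α (k ω) := by
    let P : A → M → Prop := fun a m => (∃ ω', 0 < σ ω' m) ∧ α m = a
    obtain ⟨ω₁⟩ := (inferInstance : Nonempty Ω)
    refine ⟨fun a => if h : ∃ m, P a m then h.choose else k ω₁, fun ω => ?_⟩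
    have hex : ∃ m, P (α (k ω)) m := ⟨k ω, ⟨ω, hk ω⟩, rfl⟩
    simp only [hex, dif_pos]
    exact hex.choose_spec
  obtain ⟨rep, hrep⟩ := hrep
  let σ' : Ω → M → ℝ := fun ω m => if m = rep (α (k ω)) then 1 else 0
  have hσ' : IsMsg σ' := by
    intro ω
    refine ⟨fun m => ?_, ?_⟩
    · simp only [σ']; split_ifs <;> norm_num
    · simp [σ']
  have hS' : SBR μ₀ uS σ' ρ := by
    rw [SBR_iff _ hμ _ _ _ hσ']
    intro ω m m' hpos
    have hm : m = rep (α (k ω)) := by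
      by_contra hcon
      simp [σ', hcon] at hpos
    obtain ⟨⟨ω', hω'⟩, hα'⟩ := hrep ω
    rw [hm, hval _ ω' hω' ω, hα', ← hval (k ω) ω (hk ω) ω]
    exact hS ω _ _ (hk ω)
  have hR' : RBR μ₀ uR σ' ρ := by
    rw [RBR_iff _ _ _ _ hρ]
    intro m a b hpos
    by_cases hon : ∃ ω₁, m = rep (α (k ω₁))
    · obtain ⟨ω₁, hm⟩ := hon
      obtain ⟨⟨ω', hω'⟩, hα'⟩ := hrep ω₁
      rw [← hm] at hω' hα'
      have ha : a = α (k ω₁) := by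
        rw [← hα']
        exact hpure m ω' hω' a (α m) hpos (hα m)
      have hmass : ∀ ω, σ' ω m = ∑ m'', if α m'' = a then σ ω m'' else 0 := by
        intro ω
        by_cases hω : α (k ω) = a
        · have e1 : σ' ω m = 1 := by simp [σ', hω, hm, ha]
          rw [e1, ← (hσ ω).2]
          refine Finset.sum_congr rfl fun m'' _ => ?_
          rcases ((hσ ω).1 m'').eq_or_lt with h0 | h0
          · rw [← h0]; simp
          · rw [if_pos ((huniq m'' ω h0).trans hω)]
        · have e1 : σ' ω m = 0 := by
            simp only [σ']
            rw [if_neg]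
            intro hcon
            have := (hrep ω).2
            rw [← hcon, hα', ← ha] at this
            exact hω this.symm
          rw [e1]
          symm
          refine Finset.sum_eq_zero fun m'' _ => ?_
          split_ifs with hm''
          · by_contra h0
            exact hω ((huniq m'' ω (lt_of_le_of_ne ((hσ ω).1 m'') (Ne.symm h0))).symm.trans hm'')
          · rfl
      have : ∑ ω, μ₀ ω * σ' ω m * (uR (a, ω) - uR (b, ω)) =
          ∑ m'', if α m'' = a then ∑ ω, μ₀ ω * σ ω m'' * (uR (a, ω) - uR (b, ω)) else 0 := by
        simp only [hmass, Finset.mul_sum, Finset.sum_mul]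
        rw [Finset.sum_comm]
        refine Finset.sum_congr rfl fun m'' _ => ?_
        split_ifs <;> simp
      rw [this]
      refine Finset.sum_nonneg fun m'' _ => ?_
      split_ifs with hm''
      · exact hR m'' a b (hm'' ▸ hα m'')
      · exact le_rfl
    · push Not at hon
      simp [σ', hon]
  refine ⟨σ', fun ω => ⟨rep (α (k ω)), by simp [σ']⟩, ⟨hσ', hρ, hS', hR'⟩, hS' σ hσ⟩

/-- Theorem 2 (Kamenica–Lin): generically, if cheap-talk Sender values
randomization then commitment is valuable. -/
theorem cheapTalk_randomization_implies_commitment_valuable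
    (Ω A M : Type) [Fintype Ω] [Fintype A] [Fintype M]
    [Nonempty Ω] [Nonempty A]
    (hM : max (Fintype.card Ω) (Fintype.card A) < Fintype.card M)
    (μ₀ : Ω → ℝ) (hμ : IsPrior μ₀) :
    ∃ G : Set ((A × Ω → ℝ) × (A × Ω → ℝ)),
      G ⊆ EnvCube Ω A ∧
      volume (EnvCube Ω A \ G) = 0 ∧
      ∀ e ∈ G,
        partCtPayoff (M := M) μ₀ e.1 e.2 < ctPayoff (M := M) μ₀ e.1 e.2 →
        ctPayoff (M := M) μ₀ e.1 e.2 < persPayoff (M := M) μ₀ e.1 e.2 := by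
  refine ⟨EnvCube Ω A ∩ {e | Good e}, Set.inter_subset_left, ?_, ?_⟩
  · refine measure_mono_null ?_ (volume_not_good (Ω := Ω) (A := A))
    rintro e ⟨he, hne⟩
    exact fun hg => hne ⟨he, hg⟩
  rintro ⟨uS, uR⟩ ⟨-, hgood⟩ hlt
  simp only at hlt ⊢
  have hgood : Good (uS, uR) := hgood
  have hbdd : BddAbove {x | ∃ (σ : Ω → M → ℝ) (ρ : M → A → ℝ),
      CTEq μ₀ uS uR σ ρ ∧ x = U μ₀ uS σ ρ} := by
    refine (bddAbove_pers (M := M) μ₀ uS uR).mono ?_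
    rintro x ⟨σ, ρ, h, rfl⟩
    exact ⟨σ, ρ, ⟨h.1, h.2.1, h.2.2.2⟩, rfl⟩
  by_contra hcon
  push Not at hcon
  by_cases hne : {p : (Ω → M → ℝ) × (M → A → ℝ) | CTEq μ₀ uS uR p.1 p.2}.Nonempty
  · obtain ⟨⟨σ, ρ⟩, hct, hmax⟩ := (isCompact_CTEq (M := M) μ₀ uS uR).exists_isMaxOn hne
      (continuous_U μ₀ uS).continuousOn
    have hct : CTEq μ₀ uS uR σ ρ := hct
    have hle : ctPayoff (M := M) μ₀ uS uR ≤ U μ₀ uS σ ρ := by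
      refine csSup_le ⟨_, σ, ρ, hct, rfl⟩ ?_
      rintro x ⟨σ₁, ρ₁, h₁, rfl⟩
      exact isMaxOn_iff.1 hmax (σ₁, ρ₁) h₁
    have hMA : Fintype.card A ≤ Fintype.card M := ((le_max_right _ _).trans_lt hM).le
    obtain ⟨σ', hpart, hct', hU⟩ := exists_partitional μ₀ hμ
      (fun a b ω hab => hgood.ne hab ω) σ ρ hct
      (fun m ω hm a b ha hb => pure_of_optimal hMA μ₀ hμ hgood σ ρ hct.1 hct.2.1 hct.2.2.2
        (hcon.trans hle) m ω hm a b ha hb)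
    have hp : U μ₀ uS σ' ρ ≤ partCtPayoff (M := M) μ₀ uS uR := by
      refine le_csSup (hbdd.mono ?_) ⟨σ', ρ, hpart, hct', rfl⟩
      rintro x ⟨σ₁, ρ₁, -, h₁, rfl⟩
      exact ⟨σ₁, ρ₁, h₁, rfl⟩
    linarith
  · have hno : ∀ (σ : Ω → M → ℝ) (ρ : M → A → ℝ), ¬ CTEq μ₀ uS uR σ ρ :=
      fun σ ρ h => hne ⟨(σ, ρ), h⟩
    simp [partCtPayoff, ctPayoff, hno] at hlt

end KL
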